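/- arXiv:1311.2571 — 2 statements merged into one kernel-verified Lean document; each statement's English description precedes it below -/
import Mathlib

section
/- Let M be a nonnegative 4×4 matrix with rows and columns indexed by {0,1}^2 (ordered 00, 01, 10, 11) that admits an S^2_+-factorization and satisfies M_{a,b} = 0 whenever aᵀb = 1. Then at least one of the following holds: (i) M_{01,10} = 0 and M_{10,01} = 0; (ii) M_{00,11} = 0 and M_{11,00} = 0; (iii) the row indexed by 01 is identically zero; (iv) the row indexed by 10 is identically zero; (v) the column indexed by 01 is identically zero; (vi) the column indexed by 10 is identically zero. -/
/-- Bit strings of length `n`. -/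
abbrev BitStr (n : ℕ) : Type := Fin n → Bool

/-- The inner product `aᵀb = Σᵢ aᵢbᵢ` of two bit strings (a natural number;
its value over `ℝ` is obtained by coercion). -/
def bitIP {n : ℕ} (a b : BitStr n) : ℕ := ∑ i, if a i && b i then 1 else 0

/-- `val M`: the number of pairs `(a,b) ∈ {0,1}ⁿ × {0,1}ⁿ` with `aᵀb = 0` and `M a b > 0`. -/
noncomputable def valM {n : ℕ} (M : Matrix (BitStr n) (BitStr n) ℝ) : ℕ :=
  (Finset.univ.filter fun p : BitStr n × BitStr n =>
    bitIP p.1 p.2 = 0 ∧ 0 < M p.1 p.2).card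

/-- `M` admits an `S^d_+`-factorization: `M a b = Tr(X_a Y_b)` for `d × d` real
positive semidefinite matrices `X_a` (one per row) and `Y_b` (one per column). -/
def HasPsdFactorization (d : ℕ) {n : ℕ} (M : Matrix (BitStr n) (BitStr n) ℝ) : Prop :=
  ∃ (X Y : BitStr n → Matrix (Fin d) (Fin d) ℝ),
    (∀ a, (X a).PosSemidef) ∧ (∀ b, (Y b).PosSemidef) ∧
    ∀ a b, M a b = (X a * Y b).trace

/-- The set `A_{S^d_+}(n)` of nonnegative `2^n × 2^n` matrices admitting an
`S^d_+`-factorization and vanishing on all pairs with `aᵀb = 1`. -/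
def AtomsPsd (d n : ℕ) : Set (Matrix (BitStr n) (BitStr n) ℝ) :=
  {M | (∀ a b, 0 ≤ M a b) ∧ HasPsdFactorization d M ∧
    ∀ a b, bitIP a b = 1 → M a b = 0}

/-- A rectangle: a set of pairs of the form `I × J`. -/
def IsRectangle {d : ℕ} (R : Finset (BitStr d × BitStr d)) : Prop :=
  ∃ I J : Finset (BitStr d), R = I ×ˢ J

/-- The rectangles `R 0, …, R (k-1)` witness a `k`-uniform-covering of the set `S`:
each `R i` is a rectangle supported on the disjoint pairs, and for every `M ∈ S`
there is an injective map `φ` sending each disjoint pair on which `M` is positive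
to (the index of) a rectangle containing that pair. -/
def UniformCoveringWith {d : ℕ} (S : Set (Matrix (BitStr d) (BitStr d) ℝ)) {k : ℕ}
    (R : Fin k → Finset (BitStr d × BitStr d)) : Prop :=
  (∀ i, IsRectangle (R i)) ∧
  (∀ i, ∀ p ∈ R i, bitIP p.1 p.2 = 0) ∧
  ∀ M ∈ S, ∃ φ : {p : BitStr d × BitStr d // bitIP p.1 p.2 = 0 ∧ 0 < M p.1 p.2} → Fin k,
    Function.Injective φ ∧ ∀ p, (p : BitStr d × BitStr d) ∈ R (φ p)

/-- The set `S` of `2^d × 2^d` nonnegative matrices has a `k`-uniform-covering. -/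
def HasUniformCovering {d : ℕ} (S : Set (Matrix (BitStr d) (BitStr d) ℝ)) (k : ℕ) : Prop :=
  ∃ R : Fin k → Finset (BitStr d × BitStr d), UniformCoveringWith S R

open scoped MatrixOrder Matrix.Norms.L2Operator in
/-- Positive semidefinite matrices that are orthogonal for the trace form have zero product. -/
theorem Matrix.PosSemidef.mul_eq_zero_of_trace_mul_eq_zero {m : Type*} [Fintype m]
    {A B : Matrix m m ℝ} (hA : A.PosSemidef) (hB : B.PosSemidef)
    (h : (A * B).trace = 0) : A * B = 0 := by
  classical
  obtain ⟨S, rfl⟩ := CStarAlgebra.nonneg_iff_eq_star_mul_self.mp hA.nonneg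
  obtain ⟨T, rfl⟩ := CStarAlgebra.nonneg_iff_eq_star_mul_self.mp hB.nonneg
  have hST : S * star T = 0 := by
    rw [← Matrix.trace_conjTranspose_mul_self_eq_zero_iff, ← h,
      ← Matrix.star_eq_conjTranspose, star_mul, star_star,
      show star S * S * (star T * T) = (star S * S * star T) * T by simp only [mul_assoc],
      Matrix.trace_mul_comm _ T]
    simp only [mul_assoc]
  rw [show star S * S * (star T * T) = star S * (S * star T) * T by simp only [mul_assoc], hST,
    mul_zero, zero_mul]

/-- If `A` is a nonzero `2 × 2` matrix annihilating both `P` and `R`, with `R` nonzero, then the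
range of `P` lies in the range of `R`, so everything annihilating `R` annihilates `P`. -/
theorem Matrix.mul_eq_zero_of_common_annihilator {A B P R : Matrix (Fin 2) (Fin 2) ℝ}
    (hA : A ≠ 0) (hR : R ≠ 0) (hAP : A * P = 0) (hAR : A * R = 0) (hBR : B * R = 0) :
    B * P = 0 := by
  obtain ⟨i, j, hij⟩ : ∃ i j, A i j ≠ 0 := by
    by_contra! h
    exact hA (Matrix.ext h)
  obtain ⟨k, l, hkl⟩ : ∃ k l, R k l ≠ 0 := by
    by_contra! h
    exact hR (Matrix.ext h)
  ext n m
  have h₁ : A i 0 * P 0 m + A i 1 * P 1 m = 0 := by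
    simpa [Matrix.mul_apply] using congrFun₂ hAP i m
  have h₂ : A i 0 * R 0 l + A i 1 * R 1 l = 0 := by
    simpa [Matrix.mul_apply] using congrFun₂ hAR i l
  have h₃ : B n 0 * R 0 l + B n 1 * R 1 l = 0 := by
    simpa [Matrix.mul_apply] using congrFun₂ hBR n l
  have hdet : P 0 m * R 1 l = P 1 m * R 0 l := by
    match j, hij with
    | 0, hij => exact mul_left_cancel₀ hij (by linear_combination R 1 l * h₁ - P 1 m * h₂)
    | 1, hij => exact mul_left_cancel₀ hij (by linear_combination P 0 m * h₂ - R 0 l * h₁)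
  have h : B n 0 * P 0 m + B n 1 * P 1 m = 0 := by
    match k, hkl with
    | 0, hkl => exact mul_left_cancel₀ hkl (by linear_combination P 0 m * h₃ - B n 1 * hdet)
    | 1, hkl => exact mul_left_cancel₀ hkl (by linear_combination P 1 m * h₃ + B n 0 * hdet)
  simpa [Matrix.mul_apply] using h

/-- **Sparsity lemma for `d = 2`.** Let `M` be a nonnegative `4 × 4` matrix indexed by
`{0,1}² × {0,1}²` admitting an `S^2_+`-factorization with `M a b = 0` whenever `aᵀb = 1`.
Then: (i) `M_{01,10} = M_{10,01} = 0`, or (ii) `M_{00,11} = M_{11,00} = 0`, or one of the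
rows or columns indexed by `01` or `10` is identically zero. -/
theorem sparsity_pattern_psd2
    (M : Matrix (BitStr 2) (BitStr 2) ℝ)
    (hnonneg : ∀ a b, 0 ≤ M a b)
    (hfact : HasPsdFactorization 2 M)
    (hzero : ∀ a b, bitIP a b = 1 → M a b = 0) :
    (M ![false, true] ![true, false] = 0 ∧ M ![true, false] ![false, true] = 0) ∨
    (M ![false, false] ![true, true] = 0 ∧ M ![true, true] ![false, false] = 0) ∨
    (∀ b, M ![false, true] b = 0) ∨
    (∀ b, M ![true, false] b = 0) ∨
    (∀ a, M a ![false, true] = 0) ∨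
    (∀ a, M a ![true, false] = 0) := by
  obtain ⟨X, Y, hX, hY, hM⟩ := hfact
  have hmul : ∀ a b, bitIP a b = 1 → X a * Y b = 0 := fun a b hab =>
    (hX a).mul_eq_zero_of_trace_mul_eq_zero (hY b) (by rw [← hM, hzero a b hab])
  by_cases hA : X ![false, true] = 0
  · exact .inr (.inr (.inl fun b => by simp [hM, hA]))
  by_cases hB : X ![true, false] = 0
  · exact .inr (.inr (.inr (.inl fun b => by simp [hM, hB])))
  by_cases hP : Y ![false, true] = 0
  · exact .inr (.inr (.inr (.inr (.inl fun a => by simp [hM, hP]))))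
  by_cases hQ : Y ![true, false] = 0
  · exact .inr (.inr (.inr (.inr (.inr fun a => by simp [hM, hQ]))))
  have hAP := hmul ![false, true] ![false, true] (by decide)
  have hBQ := hmul ![true, false] ![true, false] (by decide)
  by_cases hR : Y ![true, true] = 0
  · by_cases hC : X ![true, true] = 0
    · exact .inr (.inl ⟨by simp [hM, hR], by simp [hM, hC]⟩)
    · have hCP := hmul ![true, true] ![false, true] (by decide)
      have hCQ := hmul ![true, true] ![true, false] (by decide)
      left
      rw [hM, hM, Matrix.mul_eq_zero_of_common_annihilator hC hP hCQ hCP hAP,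
        Matrix.mul_eq_zero_of_common_annihilator hC hQ hCP hCQ hBQ]
      simp
  · have hAR := hmul ![false, true] ![true, true] (by decide)
    have hBR := hmul ![true, false] ![true, true] (by decide)
    left
    rw [hM, hM, Matrix.mul_eq_zero_of_common_annihilator hB hR hBQ hBR hAR,
      Matrix.mul_eq_zero_of_common_annihilator hA hR hAP hAR hBR]
    simp
end

section
/- For every d ≥ 1, the set C(d) has a (3^d − 1)-uniform-covering, where C(d) is the set of nonnegative 2^d × 2^d matrices M, with rows and columns indexed by {0,1}^d, such that M_{a,b} = 0 whenever aᵀb = 1 and such that M_{α,ᾱ} = 0 for at least one α ∈ {0,1}^d (ᾱ the bitwise complement of α). -/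
/-- The set `C(d)` of nonnegative `2^d × 2^d` matrices vanishing on all pairs with
`aᵀb = 1` and having at least one zero entry on the antidiagonal. -/
def Cset (d : ℕ) : Set (Matrix (BitStr d) (BitStr d) ℝ) :=
  {M | (∀ a b, 0 ≤ M a b) ∧ (∀ a b, bitIP a b = 1 → M a b = 0) ∧
    ∃ α : BitStr d, M α (fun i => !(α i)) = 0}

theorem bitIP_eq_zero_iff {n : ℕ} (a b : BitStr n) :
    bitIP a b = 0 ↔ ∀ i, (a i && b i) = false := by
  simp [bitIP]

theorem bitIP_cons_eq_zero_iff {n : ℕ} (x y : Bool) (a b : BitStr n) :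
    bitIP (Fin.cons x a : BitStr (n + 1)) (Fin.cons y b) = 0 ↔
      (x && y) = false ∧ bitIP a b = 0 := by
  simp only [bitIP_eq_zero_iff, Fin.forall_fin_succ, Fin.cons_zero, Fin.cons_succ]

/-- The rectangles `I i × J i` are supported on the disjoint pairs, and for every `α` one can pick
a pair in each rectangle so that all disjoint pairs other than `(α, ᾱ)` are picked. -/
def IsSelectableCovering {d : ℕ} {ι : Type} (I J : ι → Set (BitStr d)) : Prop :=
  (∀ i, ∀ a ∈ I i, ∀ b ∈ J i, bitIP a b = 0) ∧
  ∀ α : BitStr d, ∃ f g : ι → BitStr d, (∀ i, f i ∈ I i ∧ g i ∈ J i) ∧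
    ∀ a b, bitIP a b = 0 → ¬ (a = α ∧ b = fun j => !(α j)) → ∃ i, f i = a ∧ g i = b

/-- The strings whose first bit is at most `h` and whose remaining bits form a string in `s`. -/
def consLE {d : ℕ} (h : Bool) (s : Set (BitStr d)) : Set (BitStr (d + 1)) :=
  {a | a 0 ≤ h ∧ Fin.tail a ∈ s}

theorem cons_mem_consLE {d : ℕ} {h x : Bool} {s : Set (BitStr d)} {a : BitStr d} :
    (Fin.cons x a : BitStr (d + 1)) ∈ consLE h s ↔ x ≤ h ∧ a ∈ s := by
  simp [consLE]

theorem bitIP_eq_zero_of_mem_consLE {d : ℕ} {h : Bool} {s t : Set (BitStr d)}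
    (hst : ∀ a ∈ s, ∀ b ∈ t, bitIP a b = 0) :
    ∀ a ∈ consLE h s, ∀ b ∈ consLE (!h) t, bitIP a b = 0 := by
  intro a
  refine Fin.consCases (fun x a ha b => ?_) a
  refine Fin.consCases (fun y b hb => ?_) b
  rw [cons_mem_consLE] at ha hb
  refine (bitIP_cons_eq_zero_iff x y a b).2 ⟨?_, hst a ha.2 b hb.2⟩
  have hx := ha.1
  have hy := hb.1
  revert hx hy
  cases x <;> cases y <;> cases h <;> simp

theorem bitIP_not_self {d : ℕ} (a : BitStr d) : bitIP a (fun j => !(a j)) = 0 := by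
  simp [bitIP_eq_zero_iff]

/-- A covering in dimension `d` by `k` rectangles extends to one in dimension `d + 1` by
`3 * k + 2` rectangles. -/
theorem IsSelectableCovering.succ {d : ℕ} {ι : Type} {I J : ι → Set (BitStr d)}
    (H : IsSelectableCovering I J) (β : BitStr d) :
    IsSelectableCovering
      (Sum.elim (fun p : ι × Bool => consLE p.2 (I p.1))
        (Sum.elim (fun i : ι => consLE true (I i)) (fun h : Bool => consLE h {β})))
      (Sum.elim (fun p : ι × Bool => consLE (!p.2) (J p.1))
        (Sum.elim (fun i : ι => consLE false (J i))
          (fun h : Bool => consLE (!h) {fun j => !(β j)}))) := by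
  obtain ⟨hdisj, hsel⟩ := H
  refine ⟨?_, fun α => ?_⟩
  · rintro (⟨i, h⟩ | i | h)
    · exact bitIP_eq_zero_of_mem_consLE (hdisj i)
    · exact bitIP_eq_zero_of_mem_consLE (h := true) (hdisj i)
    · exact bitIP_eq_zero_of_mem_consLE (by rintro _ rfl _ rfl; exact bitIP_not_self _)
  refine Fin.consCases (fun h α => ?_) α
  obtain ⟨f, g, hfg, hcov⟩ := hsel α
  obtain ⟨u, v, huv, hcov'⟩ := hsel β
  refine ⟨Sum.elim (fun p => Fin.cons p.2 (if p.2 = h then f p.1 else u p.1))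
      (Sum.elim (fun i => Fin.cons false (u i))
        (fun c => Fin.cons (if c = h then false else c) β)),
    Sum.elim (fun p => Fin.cons (!p.2) (if p.2 = h then g p.1 else v p.1))
      (Sum.elim (fun i => Fin.cons false (v i))
        (fun c => Fin.cons (if c = h then false else !c) (fun j => !(β j)))), ?_, ?_⟩
  · rintro (⟨i, c⟩ | i | c)
    · by_cases hc : c = h <;> simp [cons_mem_consLE, hc, hfg, huv]
    · simp [cons_mem_consLE, huv]
    · by_cases hc : c = h <;> simp [cons_mem_consLE, hc]
  · intro a
    refine Fin.consCases (fun x a b => ?_) a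
    refine Fin.consCases (fun y b => ?_) b
    intro hcons hne
    obtain ⟨hxy, hab⟩ := (bitIP_cons_eq_zero_iff x y a b).1 hcons
    by_cases hy : y = !x
    · subst hy
      by_cases hx : x = h
      · subst hx
        obtain ⟨i, rfl, rfl⟩ := hcov a b hab (by
          rintro ⟨rfl, rfl⟩
          exact hne ⟨rfl, by funext j; refine Fin.cases ?_ (fun j => ?_) j <;> simp⟩)
        exact ⟨Sum.inl (i, x), by simp⟩
      · by_cases hb : a = β ∧ b = fun j => !(β j)
        · obtain ⟨rfl, rfl⟩ := hb
          exact ⟨Sum.inr (Sum.inr x), by simp [hx]⟩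
        · obtain ⟨i, rfl, rfl⟩ := hcov' a b hab hb
          exact ⟨Sum.inl (i, x), by simp [hx]⟩
    · obtain ⟨rfl, rfl⟩ : x = false ∧ y = false := by
        revert hxy hy; cases x <;> cases y <;> simp
      by_cases hb : a = β ∧ b = fun j => !(β j)
      · obtain ⟨rfl, rfl⟩ := hb
        exact ⟨Sum.inr (Sum.inr h), by simp⟩
      · obtain ⟨i, rfl, rfl⟩ := hcov' a b hab hb
        exact ⟨Sum.inr (Sum.inl i), by simp⟩

theorem exists_isSelectableCovering (d : ℕ) :
    ∃ (ι : Type) (_ : Fintype ι) (I J : ι → Set (BitStr d)),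
      Fintype.card ι + 1 = 3 ^ d ∧ IsSelectableCovering I J := by
  induction d with
  | zero =>
    refine ⟨Empty, inferInstance, Empty.elim, Empty.elim, by simp, fun i => i.elim, fun α => ?_⟩
    refine ⟨Empty.elim, Empty.elim, fun i => i.elim, fun a b _ hne => ?_⟩
    exact absurd ⟨Subsingleton.elim _ _, Subsingleton.elim _ _⟩ hne
  | succ d ih =>
    obtain ⟨ι, _, I, J, hcard, H⟩ := ih
    refine ⟨_, inferInstance, _, _, ?_, H.succ fun _ => false⟩
    simp only [Fintype.card_sum, Fintype.card_prod, Fintype.card_bool, pow_succ]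
    omega

/-- For every `d ≥ 1`, the set `C(d)` has a `(3^d - 1)`-uniform-covering. -/
theorem cset_uniformCovering (d : ℕ) (hd : 1 ≤ d) :
    HasUniformCovering (Cset d) (3 ^ d - 1) := by
  classical
  obtain ⟨ι, _, I, J, hcard, hdisj, hsel⟩ := exists_isSelectableCovering d
  let e : ι ≃ Fin (3 ^ d - 1) := Fintype.equivFinOfCardEq (by omega)
  refine ⟨fun k => (I (e.symm k)).toFinset ×ˢ (J (e.symm k)).toFinset,
    fun k => ⟨_, _, rfl⟩, fun k p hp => ?_, ?_⟩
  · simp only [Finset.mem_product, Set.mem_toFinset] at hp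
    exact hdisj _ _ hp.1 _ hp.2
  · rintro M ⟨-, -, α, hα⟩
    obtain ⟨f, g, hfg, hcov⟩ := hsel α
    have hex : ∀ p : {p : BitStr d × BitStr d // bitIP p.1 p.2 = 0 ∧ 0 < M p.1 p.2},
        ∃ i, f i = p.1.1 ∧ g i = p.1.2 := by
      rintro ⟨⟨a, b⟩, hab, hM⟩
      refine hcov a b hab ?_
      rintro ⟨rfl, rfl⟩
      exact hM.ne' hα
    choose φ hφ using hex
    refine ⟨fun p => e (φ p), fun p q hpq => ?_, fun p => ?_⟩
    · have h : φ p = φ q := e.injective hpq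
      refine Subtype.ext (Prod.ext ?_ ?_)
      · rw [← (hφ p).1, ← (hφ q).1, h]
      · rw [← (hφ p).2, ← (hφ q).2, h]
    · simp only [Equiv.symm_apply_apply, Finset.mem_product, Set.mem_toFinset]
      rw [← (hφ p).1, ← (hφ p).2]
      exact hfg _
end
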